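/- Let 0 ≤ k ≤ d and let A₁, …, A_k, S₁, …, S_{d−k}, T₁, …, T_{d−k} be independent standard Gaussian random vectors in ℝ^d. Let B_S be the (ε/2)-neighborhood of the affine hull of {A₁, …, A_k, S₁, …, S_{d−k}} and B_T the (ε/2)-neighborhood of the affine hull of {A₁, …, A_k, T₁, …, T_{d−k}}. Then for every t > 2π, ℙ( 𝒢(B_S ∩ B_T) ≥ ε²·t/√(2π) ) ≤ 3·( π^{3/2} / √(2t) )^{d−k−2}. -/

import Mathlib

open MeasureTheory ProbabilityTheory

/-- The standard Gaussian probability measure on `ℝ^d`. -/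
noncomputable def stdGaussian (d : ℕ) : Measure (EuclideanSpace ℝ (Fin d)) :=
  (Measure.pi fun _ : Fin d => gaussianReal 0 1).map
    (MeasurableEquiv.toLp 2 (Fin d → ℝ))

section Gaussian

variable {E : Type*} [NormedAddCommGroup E] [InnerProductSpace ℝ E] [FiniteDimensional ℝ E]
  [MeasurableSpace E] [BorelSpace E]

/-- The coordinates of a standard Gaussian vector along an orthonormal family are independent
standard real Gaussians. -/
theorem map_inner_stdGaussian {ι : Type*} [Fintype ι] {f : ι → E} (hf : Orthonormal ℝ f) :
    (ProbabilityTheory.stdGaussian E).map (fun x i => inner ℝ (f i) x) =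
      Measure.pi fun _ : ι => gaussianReal 0 1 := by
  have key : (ProbabilityTheory.stdGaussian E).map
      (fun x => WithLp.toLp 2 (fun i => inner ℝ (f i) x : ι → ℝ)) =
      ProbabilityTheory.stdGaussian (EuclideanSpace ℝ ι) := by
    have hm' : Measurable (fun x : E => WithLp.toLp 2 (fun i => inner ℝ (f i) x : ι → ℝ)) := by
      fun_prop
    have : IsProbabilityMeasure ((ProbabilityTheory.stdGaussian E).map
      (fun x => WithLp.toLp 2 (fun i => inner ℝ (f i) x : ι → ℝ))) :=
      Measure.isProbabilityMeasure_map hm'.aemeasurable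
    apply Measure.ext_of_charFun
    ext t
    rw [charFun_stdGaussian, charFun_apply, integral_map hm'.aemeasurable (by fun_prop)]
    have h1 : ∀ x : E, inner ℝ (WithLp.toLp 2 (fun i => inner ℝ (f i) x : ι → ℝ)) t =
        inner ℝ x (∑ i, t i • f i) := by
      intro x
      simp only [PiLp.inner_apply, inner_sum, inner_smul_right]
      refine Finset.sum_congr rfl fun i _ => ?_
      simp [real_inner_comm]
    simp_rw [h1]
    rw [← charFun_apply, charFun_stdGaussian]
    have h2 : ‖∑ i, t i • f i‖ ^ 2 = ‖t‖ ^ 2 := by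
      rw [← real_inner_self_eq_norm_sq, hf.inner_sum, EuclideanSpace.norm_sq_eq]
      simp [sq]
    norm_cast
    rw [h2]
  have h3 := congrArg (Measure.map (WithLp.ofLp : EuclideanSpace ℝ ι → ι → ℝ)) key
  rw [← map_pi_eq_stdGaussian, Measure.map_map (by fun_prop) (by fun_prop),
    Measure.map_map (by fun_prop) (by fun_prop)] at h3
  simpa [Function.comp_def] using h3

theorem gaussianReal_Icc_le (a b : ℝ) :
    gaussianReal 0 1 (Set.Icc a b) ≤ ENNReal.ofReal ((b - a) / Real.sqrt (2 * Real.pi)) := by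
  rw [gaussianReal_apply _ one_ne_zero]
  calc ∫⁻ x in Set.Icc a b, gaussianPDF 0 1 x
      ≤ ∫⁻ _ in Set.Icc a b, ENNReal.ofReal (Real.sqrt (2 * Real.pi))⁻¹ := by
        refine lintegral_mono fun x => ENNReal.ofReal_le_ofReal ?_
        rw [gaussianPDFReal]
        simp only [NNReal.coe_one, mul_one]
        refine mul_le_of_le_one_right (by positivity) (Real.exp_le_one_iff.2 ?_)
        have := sq_nonneg (x - 0)
        linarith
    _ = ENNReal.ofReal ((b - a) / Real.sqrt (2 * Real.pi)) := by
        rw [setLIntegral_const, Real.volume_Icc, ← ENNReal.ofReal_mul (by positivity)]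
        congr 1
        ring

theorem integral_exp_mul_sq_gaussianReal {c : ℝ} (hc : c < 1 / 2) :
    Integrable (fun x => Real.exp (c * x ^ 2)) (gaussianReal 0 1) ∧
      ∫ x, Real.exp (c * x ^ 2) ∂(gaussianReal 0 1) = (Real.sqrt (1 - 2 * c))⁻¹ := by
  have h : ∀ x : ℝ, gaussianPDFReal 0 1 x • Real.exp (c * x ^ 2) =
      (Real.sqrt (2 * Real.pi))⁻¹ * Real.exp (-(1 / 2 - c) * x ^ 2) := by
    intro x
    rw [gaussianPDFReal, smul_eq_mul]
    simp only [NNReal.coe_one, mul_one]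
    rw [mul_assoc, ← Real.exp_add]
    congr 2
    ring
  constructor
  · rw [gaussianReal_of_var_ne_zero _ one_ne_zero, gaussianPDF_def,
      integrable_withDensity_iff_integrable_smul₀' (by fun_prop) (by simp)]
    refine ((integrable_exp_neg_mul_sq (sub_pos.2 hc)).const_mul
      (Real.sqrt (2 * Real.pi))⁻¹).congr (ae_of_all _ fun x => ?_)
    simp only
    rw [ENNReal.toReal_ofReal (gaussianPDFReal_nonneg _ _ _), h]
  · rw [integral_gaussianReal_eq_integral_smul one_ne_zero]
    simp_rw [h]
    rw [integral_const_mul, integral_gaussian, ← Real.sqrt_inv, ← Real.sqrt_inv,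
      ← Real.sqrt_mul (by positivity)]
    congr 1
    have : (1 / 2 - c) ≠ 0 := by linarith
    have : 1 - 2 * c ≠ 0 := by linarith
    have := Real.pi_ne_zero
    field_simp

/-- Two slabs of width `ε` whose unit normals satisfy `1 - ⟪u, v⟫ ^ 2 > 0` meet in a set of small
Gaussian measure. -/
theorem stdGaussian_slab_inter_slab_le {u v : E} (hu : ‖u‖ = 1) (hv : ‖v‖ = 1) {s : ℝ}
    (hs : 0 < s) (hsuv : s ^ 2 = 1 - inner ℝ u v ^ 2) (a b : ℝ) {ε : ℝ} (hε : 0 ≤ ε) :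
    ProbabilityTheory.stdGaussian E
        ({x | |inner ℝ u x - a| ≤ ε / 2} ∩ {x | |inner ℝ v x - b| ≤ ε / 2}) ≤
      ENNReal.ofReal (ε ^ 2 / (2 * Real.pi * s)) := by
  set c := inner ℝ u v with hc
  set w : E := s⁻¹ • (v - c • u) with hw
  have huu : inner ℝ u u = (1 : ℝ) := by rw [real_inner_self_eq_norm_sq, hu]; norm_num
  have hvv : inner ℝ v v = (1 : ℝ) := by rw [real_inner_self_eq_norm_sq, hv]; norm_num
  have huw : inner ℝ u w = 0 := by
    rw [hw, inner_smul_right, inner_sub_right, inner_smul_right, huu, ← hc]; ring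
  have hwn : ‖w‖ = 1 := by
    have : inner ℝ w w = (1 : ℝ) := by
      rw [hw]
      simp only [inner_smul_left, inner_smul_right, inner_sub_left, inner_sub_right, huu, hvv,
        real_inner_comm u v, ← hc]
      simp only [conj_trivial]
      field_simp
      linarith
    rw [real_inner_self_eq_norm_sq] at this
    nlinarith [norm_nonneg w]
  have hvw : v = c • u + s • w := by
    rw [hw, smul_smul, mul_inv_cancel₀ hs.ne', one_smul]; abel
  have hon : Orthonormal ℝ ![u, w] := by
    rw [orthonormal_iff_ite]
    intro i j
    fin_cases i <;> fin_cases j <;> simp [hu, huw, hwn, real_inner_comm]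
  have hmp : MeasurePreserving (fun x : E => (inner ℝ u x, inner ℝ w x))
      (ProbabilityTheory.stdGaussian E) ((gaussianReal 0 1).prod (gaussianReal 0 1)) := by
    have h1 : MeasurePreserving (fun (x : E) i => inner ℝ (![u, w] i) x)
      (ProbabilityTheory.stdGaussian E) (Measure.pi fun _ : Fin 2 => gaussianReal 0 1) :=
      ⟨by fun_prop, map_inner_stdGaussian hon⟩
    exact (measurePreserving_finTwoArrow (gaussianReal 0 1)).comp h1
  set P : Set (ℝ × ℝ) := {y | |y.1 - a| ≤ ε / 2 ∧ |c * y.1 + s * y.2 - b| ≤ ε / 2} with hP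
  have hPm : MeasurableSet P := by
    apply IsClosed.measurableSet
    apply IsClosed.and <;> exact isClosed_le (by fun_prop) (by fun_prop)
  have hset : ({x : E | |inner ℝ u x - a| ≤ ε / 2} ∩ {x | |inner ℝ v x - b| ≤ ε / 2}) =
      (fun x : E => (inner ℝ u x, inner ℝ w x)) ⁻¹' P := by
    ext x
    have : inner ℝ v x = c * inner ℝ u x + s * inner ℝ w x := by
      rw [hvw, inner_add_left, real_inner_smul_left, real_inner_smul_left]
    simp only [Set.mem_inter_iff, Set.mem_ofPred_eq, hP, Set.mem_preimage, this]
  rw [hset, hmp.measure_preimage hPm.nullMeasurableSet, Measure.prod_apply hPm]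
  have hle : ∀ y, gaussianReal 0 1 (Prod.mk y ⁻¹' P) ≤
      (Set.Icc (a - ε / 2) (a + ε / 2)).indicator
        (fun _ => ENNReal.ofReal (ε / s / Real.sqrt (2 * Real.pi))) y := by
    intro y
    by_cases hy : y ∈ Set.Icc (a - ε / 2) (a + ε / 2)
    · rw [Set.indicator_of_mem hy]
      refine (measure_mono (t := Set.Icc ((b - ε / 2 - c * y) / s) ((b + ε / 2 - c * y) / s))
        ?_).trans ((gaussianReal_Icc_le _ _).trans_eq ?_)
      · intro z hz
        obtain ⟨h1, h2⟩ := abs_le.1 hz.2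
        simp only at h1 h2
        rw [Set.mem_Icc, div_le_iff₀ hs, le_div_iff₀ hs]
        constructor <;> linarith
      · congr 2
        field_simp
        ring
    · rw [Set.indicator_of_notMem hy, nonpos_iff_eq_zero]
      have hempty : Prod.mk y ⁻¹' P = ∅ := by
        refine Set.eq_empty_of_forall_notMem fun z hz => hy ?_
        obtain ⟨h1, h2⟩ := abs_le.1 hz.1
        simp only at h1 h2
        constructor <;> linarith
      rw [hempty, measure_empty]
  refine (lintegral_mono hle).trans ?_
  rw [lintegral_indicator_const measurableSet_Icc]
  refine (mul_le_mul_right (gaussianReal_Icc_le _ _) _).trans_eq ?_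
  rw [← ENNReal.ofReal_mul (by positivity)]
  congr 1
  have h2 : Real.sqrt (2 * Real.pi) * Real.sqrt (2 * Real.pi) = 2 * Real.pi :=
    Real.mul_self_sqrt (by positivity)
  rw [add_sub_sub_cancel, add_halves, div_div, div_mul_div_comm, mul_assoc s, h2, ← sq, mul_comm s]

/-- A standard Gaussian vector is unlikely to be close to the plane spanned by two given orthonormal
vectors. -/
theorem stdGaussian_near_plane_le {m : ℕ} {f : Fin 2 ⊕ Fin m → E} (hf : Orthonormal ℝ f)
    {δ : ℝ} (hδ : 0 < δ) (hδ1 : δ < 1) :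
    ProbabilityTheory.stdGaussian E
        {x | (1 - δ ^ 2) * ∑ i, inner ℝ (f i) x ^ 2 ≤
          inner ℝ (f (Sum.inl 0)) x ^ 2 + inner ℝ (f (Sum.inl 1)) x ^ 2} ≤
      ENNReal.ofReal (2 * (Real.sqrt 2 * δ) ^ m) := by
  have hδ2 : 0 < 1 - δ ^ 2 := by nlinarith
  set lam : ℝ := (1 - δ ^ 2) / (4 * δ ^ 2) with hlam
  have hlam0 : 0 < lam := by positivity
  let c : Fin 2 ⊕ Fin m → ℝ := Sum.elim (fun _ => 1 / 4) (fun _ => -lam)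
  have hc : ∀ i, c i < 1 / 2 := by
    rintro (i | i)
    · norm_num [c]
    · simp only [c, Sum.elim_inr]; linarith
  have hmp : MeasurePreserving (fun (x : E) i => inner ℝ (f i) x)
      (ProbabilityTheory.stdGaussian E)
      (Measure.pi fun _ : Fin 2 ⊕ Fin m => gaussianReal 0 1) :=
    ⟨by fun_prop, map_inner_stdGaussian hf⟩
  let g : (Fin 2 ⊕ Fin m → ℝ) → ℝ := fun y => ∏ i, Real.exp (c i * y i ^ 2)
  have hgint : Integrable g (Measure.pi fun _ => gaussianReal 0 1) :=
    Integrable.fintype_prod fun i => (integral_exp_mul_sq_gaussianReal (hc i)).1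
  have hgval : ∫ y, g y ∂(Measure.pi fun _ => gaussianReal 0 1) =
      2 * ((Real.sqrt (1 + 2 * lam))⁻¹) ^ m := by
    simp only [g]
    rw [integral_fintype_prod_eq_prod (f := fun i (y : ℝ) => Real.exp (c i * y ^ 2))]
    simp_rw [fun i => (integral_exp_mul_sq_gaussianReal (hc i)).2]
    rw [Fintype.prod_sum_type]
    simp only [c, Sum.elim_inl, Sum.elim_inr, Finset.prod_const, Finset.card_univ,
      Fintype.card_fin]
    congr 1
    · rw [inv_pow, Real.sq_sqrt (by norm_num)]; norm_num
    · congr 3; ring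
  have hsub : {x : E | (1 - δ ^ 2) * ∑ i, inner ℝ (f i) x ^ 2 ≤
          inner ℝ (f (Sum.inl 0)) x ^ 2 + inner ℝ (f (Sum.inl 1)) x ^ 2} ⊆
      (fun (x : E) i => inner ℝ (f i) x) ⁻¹' {y | 1 ≤ g y} := by
    intro x hx
    simp only [Set.mem_ofPred_eq, Set.mem_preimage, g] at hx ⊢
    rw [← Real.exp_sum, Real.one_le_exp_iff, Fintype.sum_sum_type]
    rw [Fintype.sum_sum_type] at hx
    simp only [c, Sum.elim_inl, Sum.elim_inr, Fin.sum_univ_two] at hx ⊢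
    rw [← Finset.mul_sum]
    set B := ∑ i, inner ℝ (f (Sum.inr i)) x ^ 2
    set A := inner ℝ (f (Sum.inl 0)) x ^ 2
    set A' := inner ℝ (f (Sum.inl 1)) x ^ 2
    have : lam * B ≤ 1 / 4 * (A + A') := by
      rw [hlam, div_mul_eq_mul_div, div_le_iff₀ (by positivity)]
      nlinarith
    linarith
  have hgm : MeasurableSet {y | 1 ≤ g y} := measurableSet_le measurable_const (by fun_prop)
  refine (measure_mono hsub).trans ?_
  rw [hmp.measure_preimage hgm.nullMeasurableSet]
  have hmarkov := mul_meas_ge_le_integral_of_nonneg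
    (μ := Measure.pi fun _ : Fin 2 ⊕ Fin m => gaussianReal 0 1) (f := g)
    (ae_of_all _ fun y => Finset.prod_nonneg fun i _ => (Real.exp_pos _).le) hgint 1
  rw [one_mul, hgval] at hmarkov
  rw [← ENNReal.ofReal_toReal (measure_ne_top _ _)]
  refine ENNReal.ofReal_le_ofReal (hmarkov.trans ?_)
  gcongr
  rw [inv_le_comm₀ (by positivity) (by positivity)]
  apply Real.le_sqrt_of_sq_le
  have : (Real.sqrt 2 * δ)⁻¹ ^ 2 = 1 / (2 * δ ^ 2) := by
    rw [inv_pow, mul_pow, Real.sq_sqrt (by norm_num), one_div]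
  rw [this, hlam]
  field_simp
  nlinarith

end Gaussian

section Rotation

/-- Projecting along a compact space, a closed condition together with a strict inequality between
continuous functions defines a measurable set. -/
theorem measurableSet_forall_mem_le {X K : Type*} [TopologicalSpace X] [MeasurableSpace X]
    [BorelSpace X] [TopologicalSpace K] [CompactSpace K] {C : Set (X × K)} (hC : IsClosed C)
    {f g : X × K → ℝ} (hf : Continuous f) (hg : Continuous g) :
    MeasurableSet {x | ∀ y, (x, y) ∈ C → f (x, y) ≤ g (x, y)} := by
  have h : {x | ∀ y, (x, y) ∈ C → f (x, y) ≤ g (x, y)}ᶜ =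
      ⋃ n : ℕ, Prod.fst '' (C ∩ {z | g z + 1 / ((n : ℝ) + 1) ≤ f z}) := by
    ext x
    simp only [Set.mem_compl_iff, Set.mem_ofPred_eq, not_forall, not_le, Set.mem_iUnion,
      Set.mem_image, Set.mem_inter_iff, Prod.exists, exists_prop]
    constructor
    · rintro ⟨y, hy, hlt⟩
      obtain ⟨n, hn⟩ := exists_nat_one_div_lt (sub_pos.2 hlt)
      exact ⟨n, x, y, ⟨hy, by linarith⟩, rfl⟩
    · rintro ⟨n, x', y, ⟨hy, hle⟩, rfl⟩
      have : (0 : ℝ) < 1 / ((n : ℝ) + 1) := by positivity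
      exact ⟨y, hy, by linarith⟩
  rw [← MeasurableSet.compl_iff, h]
  exact MeasurableSet.iUnion fun n => (isClosedMap_fst_of_compactSpace _
    (hC.inter (isClosed_le (by fun_prop) (by fun_prop)))).measurableSet

variable {E : Type*} [NormedAddCommGroup E] [InnerProductSpace ℝ E] [FiniteDimensional ℝ E]

/-- A subspace of dimension at least `#J + 2` contains an orthonormal pair orthogonal to a family
of vectors indexed by `J`. -/
theorem exists_orthonormal_pair_orthogonal {ι : Type*} (W : Submodule ℝ E) (J : Finset ι)
    (y : ι → E) (hdim : J.card + 2 ≤ Module.finrank ℝ W) :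
    ∃ p q : E, p ∈ W ∧ q ∈ W ∧ ‖p‖ = 1 ∧ ‖q‖ = 1 ∧ inner ℝ p q = 0 ∧
      (∀ j ∈ J, inner ℝ p (y j) = 0) ∧ ∀ j ∈ J, inner ℝ q (y j) = 0 := by
  let φ : W →ₗ[ℝ] (J → ℝ) := LinearMap.pi fun j => (innerₗ E (y j)).comp W.subtype
  have hker : 2 ≤ Module.finrank ℝ (LinearMap.ker φ) := by
    have h1 := LinearMap.finrank_range_add_finrank_ker φ
    have h2 := (LinearMap.range φ).finrank_le
    rw [Module.finrank_fintype_fun_eq_card, Fintype.card_coe] at h2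
    omega
  let b := stdOrthonormalBasis ℝ (LinearMap.ker φ)
  let i₀ : Fin (Module.finrank ℝ (LinearMap.ker φ)) := ⟨0, by omega⟩
  let i₁ : Fin (Module.finrank ℝ (LinearMap.ker φ)) := ⟨1, by omega⟩
  have hne : i₀ ≠ i₁ := by simp [i₀, i₁, Fin.ext_iff]
  have horth : ∀ i, ∀ j ∈ J, inner ℝ ((b i : W) : E) (y j) = 0 := by
    intro i j hj
    have := congrFun (LinearMap.mem_ker.1 (b i).2) ⟨j, hj⟩
    rw [real_inner_comm]
    simpa [φ] using this
  refine ⟨(b i₀ : W), (b i₁ : W), (b i₀ : W).2, (b i₁ : W).2, b.orthonormal.1 i₀,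
    b.orthonormal.1 i₁, b.orthonormal.2 hne, horth _, horth _⟩

/-- An orthonormal pair in a subspace of dimension at least `m + 2` extends to an orthonormal family
of `2 + m` vectors of that subspace. -/
theorem exists_orthonormal_extension (W : Submodule ℝ E) {m : ℕ}
    (hdim : m + 2 ≤ Module.finrank ℝ W) {p q : E} (hpW : p ∈ W) (hqW : q ∈ W) (hp : ‖p‖ = 1)
    (hq : ‖q‖ = 1) (hpq : inner ℝ p q = 0) :
    ∃ f : Fin 2 ⊕ Fin m → E, Orthonormal ℝ f ∧ (∀ i, f i ∈ W) ∧
      f (Sum.inl 0) = p ∧ f (Sum.inl 1) = q := by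
  let φ : W →ₗ[ℝ] (Fin 2 → ℝ) := LinearMap.pi fun j => (innerₗ E (![p, q] j)).comp W.subtype
  have hker : m ≤ Module.finrank ℝ (LinearMap.ker φ) := by
    have h1 := LinearMap.finrank_range_add_finrank_ker φ
    have h2 := (LinearMap.range φ).finrank_le
    rw [Module.finrank_fin_fun] at h2
    omega
  let b := stdOrthonormalBasis ℝ (LinearMap.ker φ)
  let e : Fin m → LinearMap.ker φ := fun i => b (Fin.castLE hker i)
  have he : ∀ i, inner ℝ p ((e i : W) : E) = 0 ∧ inner ℝ q ((e i : W) : E) = 0 := by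
    intro i
    have h := LinearMap.mem_ker.1 (e i).2
    exact ⟨congrFun h 0, congrFun h 1⟩
  have heo : ∀ i j, inner ℝ ((e i : W) : E) ((e j : W) : E) = if i = j then (1 : ℝ) else 0 := by
    intro i j
    have := orthonormal_iff_ite.1 b.orthonormal (Fin.castLE hker i) (Fin.castLE hker j)
    simpa [e, Fin.castLE_inj] using this
  refine ⟨Sum.elim ![p, q] fun i => ((e i : W) : E), ?_, ?_, rfl, rfl⟩
  · rw [orthonormal_iff_ite]
    rintro (i | i) (j | j)
    · fin_cases i <;> fin_cases j <;> simp [hp, hq, hpq, real_inner_comm]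
    · fin_cases i <;> simp [he]
    · fin_cases j <;> simp [real_inner_comm, he]
    · simp [heo]
  · rintro (i | i)
    · fin_cases i <;> simpa
    · exact (e i : W).2

variable [MeasurableSpace E] [BorelSpace E]

/-- The probability that a fixed unit vector `v ∈ W` is close to every plane of `W` orthogonal to
the differences `S j - S j₀`, `j ∈ J`, of independent standard Gaussian vectors. -/
theorem pi_stdGaussian_near_planes_le {ι : Type*} [Fintype ι] (W : Submodule ℝ E) (J : Finset ι)
    (j₀ : ι) {m : ℕ} (hJ : J.card + 2 ≤ Module.finrank ℝ W) (hm : m + 2 ≤ Module.finrank ℝ W)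
    {v : E} (hvW : v ∈ W) (hv : ‖v‖ = 1) {δ : ℝ} (hδ : 0 < δ) (hδ1 : δ < 1) :
    (Measure.pi fun _ : ι => ProbabilityTheory.stdGaussian E)
        {S | ∀ p q : E, p ∈ W → q ∈ W → ‖p‖ = 1 → ‖q‖ = 1 → inner ℝ p q = 0 →
          (∀ j ∈ J, inner ℝ p (S j - S j₀) = 0) → (∀ j ∈ J, inner ℝ q (S j - S j₀) = 0) →
          1 - δ ^ 2 ≤ inner ℝ p v ^ 2 + inner ℝ q v ^ 2} ≤
      ENNReal.ofReal (2 * (Real.sqrt 2 * δ) ^ m) := by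
  set μ := Measure.pi fun _ : ι => ProbabilityTheory.stdGaussian E with hμ
  set Fv := {S : ι → E | ∀ p q : E, p ∈ W → q ∈ W → ‖p‖ = 1 → ‖q‖ = 1 → inner ℝ p q = 0 →
          (∀ j ∈ J, inner ℝ p (S j - S j₀) = 0) → (∀ j ∈ J, inner ℝ q (S j - S j₀) = 0) →
          1 - δ ^ 2 ≤ inner ℝ p v ^ 2 + inner ℝ q v ^ 2} with hFv
  let C : Set ((E × (ι → E)) × Metric.sphere (0 : E) 1 × Metric.sphere (0 : E) 1) := {z | ((z.2.1 : E) ∈ W ∧ (z.2.2 : E) ∈ W) ∧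
    inner ℝ (z.2.1 : E) (z.2.2 : E) = 0 ∧ (∀ j ∈ J, inner ℝ (z.2.1 : E) (z.1.2 j - z.1.2 j₀) = 0) ∧
      ∀ j ∈ J, inner ℝ (z.2.2 : E) (z.1.2 j - z.1.2 j₀) = 0}
  have hC : IsClosed C := by
    have hW : IsClosed (W : Set E) := W.closed_of_finiteDimensional
    have hcl (g : (E × (ι → E)) × Metric.sphere (0 : E) 1 × Metric.sphere (0 : E) 1 → E)
        (hg : Continuous g) :
        IsClosed {z | ∀ j ∈ J, inner ℝ (g z) (z.1.2 j - z.1.2 j₀) = 0} := by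
      simp only [Set.ofPred_forall]
      exact isClosed_biInter fun j _ => isClosed_eq (by fun_prop) (by fun_prop)
    exact ((hW.preimage (by fun_prop)).inter (hW.preimage (by fun_prop))).inter
      ((isClosed_eq (by fun_prop) (by fun_prop)).inter
        ((hcl _ (by fun_prop)).inter (hcl _ (by fun_prop))))
  let F : Set (E × (ι → E)) := {x | ∀ y : Metric.sphere (0 : E) 1 × Metric.sphere (0 : E) 1, (x, y) ∈ C →
    (1 - δ ^ 2) * ‖W.starProjection x.1‖ ^ 2 ≤
      inner ℝ (y.1 : E) x.1 ^ 2 + inner ℝ (y.2 : E) x.1 ^ 2}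
  have hF : MeasurableSet F := measurableSet_forall_mem_le hC
    (f := fun z => (1 - δ ^ 2) * ‖W.starProjection z.1.1‖ ^ 2)
    (g := fun z => inner ℝ (z.2.1 : E) z.1.1 ^ 2 + inner ℝ (z.2.2 : E) z.1.1 ^ 2)
    (by fun_prop) (by fun_prop)
  have hinner : ∀ p ∈ W, ∀ x, inner ℝ p (W.starProjection x) = inner ℝ p x := by
    intro p hp x
    rw [← W.inner_starProjection_left_eq_right, W.starProjection_eq_self_iff.2 hp]
  have hlower : ∀ x, μ Fv ≤ μ (Prod.mk x ⁻¹' F) := by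
    intro x
    set x' := W.starProjection x with hx'
    by_cases hx0 : x' = 0
    · have : Prod.mk x ⁻¹' F = Set.univ := by
        refine Set.eq_univ_of_forall fun S y _ => ?_
        simp only [← hx', hx0]
        norm_num
        positivity
      rw [this]
      exact measure_mono (Set.subset_univ _)
    have hx'W : x' ∈ W := W.starProjection_apply_mem x
    have hnpos : 0 < ‖x'‖ := norm_pos_iff.2 hx0
    set x'' : E := ‖x'‖⁻¹ • x' with hx''
    have hx''n : ‖x''‖ = 1 := by
      rw [hx'', norm_smul, norm_inv, norm_norm, inv_mul_cancel₀ hnpos.ne']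
    have hx''W : x'' ∈ W := W.smul_mem _ hx'W
    set R := (ℝ ∙ (v - x''))ᗮ.reflection with hR
    have hRv : R v = x'' := Submodule.reflection_sub (hv.trans hx''n.symm)
    have hRW : ∀ w ∈ W, R w ∈ W := by
      intro w hw
      have hmem : ((ℝ ∙ (v - x'')).starProjection w) ∈ W := by
        have h1 := (ℝ ∙ (v - x'')).starProjection_apply_mem w
        obtain ⟨c, hc⟩ := Submodule.mem_span_singleton.1 h1
        rw [← hc]
        exact W.smul_mem _ (W.sub_mem hvW hx''W)
      rw [hR, Submodule.reflection_orthogonal_apply, Submodule.reflection_apply]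
      exact W.neg_mem (W.sub_mem (nsmul_mem hmem 2) hw)
    have hmp : MeasurePreserving (fun (S : ι → E) i => R (S i)) μ μ :=
      measurePreserving_pi _ _ fun _ => ⟨R.continuous.measurable, stdGaussian_map R⟩
    let Re : (ι → E) ≃ᵐ (ι → E) :=
      MeasurableEquiv.piCongrRight fun _ => R.toHomeomorph.toMeasurableEquiv
    have hpre : μ (Re ⁻¹' Fv) = μ Fv := MeasurePreserving.measure_preimage_equiv (f := Re) hmp Fv
    rw [← hpre]
    refine measure_mono fun S hS y hy => ?_
    obtain ⟨⟨hpW, hqW⟩, hpq, hpS, hqS⟩ := hy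
    have hdiff : ∀ j, Re S j - Re S j₀ = R (S j - S j₀) := fun j => (map_sub R _ _).symm
    have h := hS (R y.1) (R y.2) (hRW _ hpW) (hRW _ hqW)
      ((R.norm_map _).trans (norm_eq_of_mem_sphere y.1))
      ((R.norm_map _).trans (norm_eq_of_mem_sphere y.2))
      ((R.inner_map_map _ _).trans hpq)
      (fun j hj => by rw [hdiff, R.inner_map_map]; exact hpS j hj)
      (fun j hj => by rw [hdiff, R.inner_map_map]; exact hqS j hj)
    have hRx : v = R x'' := by rw [← hRv, hR, Submodule.reflection_reflection]
    have hxs : x' = ‖x'‖ • x'' := by rw [hx'', smul_smul, mul_inv_cancel₀ hnpos.ne', one_smul]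
    rw [hRx, R.inner_map_map, R.inner_map_map] at h
    simp only
    rw [← hinner _ hpW, ← hinner _ hqW, ← hx']
    have hp' : inner ℝ (y.1 : E) x' = ‖x'‖ * inner ℝ (y.1 : E) x'' := by
      conv_lhs => rw [hxs]
      exact real_inner_smul_right _ _ _
    have hq' : inner ℝ (y.2 : E) x' = ‖x'‖ * inner ℝ (y.2 : E) x'' := by
      conv_lhs => rw [hxs]
      exact real_inner_smul_right _ _ _
    rw [hp', hq']
    nlinarith [mul_le_mul_of_nonneg_left h (sq_nonneg ‖x'‖)]
  have hupper : ∀ S, ProbabilityTheory.stdGaussian E ((fun x => (x, S)) ⁻¹' F) ≤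
      ENNReal.ofReal (2 * (Real.sqrt 2 * δ) ^ m) := by
    intro S
    obtain ⟨p, q, hpW, hqW, hp, hq, hpq, hpS, hqS⟩ :=
      exists_orthonormal_pair_orthogonal W J (fun j => S j - S j₀) hJ
    obtain ⟨f, hf, hfW, hf0, hf1⟩ := exists_orthonormal_extension W hm hpW hqW hp hq hpq
    refine (measure_mono fun x hx => ?_).trans (stdGaussian_near_plane_le hf hδ hδ1)
    have h := hx (⟨p, by simpa using hp⟩, ⟨q, by simpa using hq⟩) ⟨⟨hpW, hqW⟩, hpq, hpS, hqS⟩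
    simp only at h
    simp only [Set.mem_ofPred_eq, hf0, hf1]
    refine le_trans (mul_le_mul_of_nonneg_left ?_ (by nlinarith)) h
    have hb := hf.sum_inner_products_le (W.starProjection x) (s := Finset.univ)
    simpa only [hinner _ (hfW _), Real.norm_eq_abs, sq_abs] using hb
  calc μ Fv = ∫⁻ _, μ Fv ∂(ProbabilityTheory.stdGaussian E) := by simp
    _ ≤ ∫⁻ x, μ (Prod.mk x ⁻¹' F) ∂(ProbabilityTheory.stdGaussian E) := lintegral_mono hlower
    _ = ((ProbabilityTheory.stdGaussian E).prod μ) F := (Measure.prod_apply hF).symm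
    _ = ∫⁻ S, ProbabilityTheory.stdGaussian E ((fun x => (x, S)) ⁻¹' F) ∂μ :=
      Measure.prod_apply_symm hF
    _ ≤ ∫⁻ _, ENNReal.ofReal (2 * (Real.sqrt 2 * δ) ^ m) ∂μ := lintegral_mono hupper
    _ = ENNReal.ofReal (2 * (Real.sqrt 2 * δ) ^ m) := by simp [hμ]

end Rotation

section Hyperplanes

variable {E : Type*} [NormedAddCommGroup E] [InnerProductSpace ℝ E]

theorem mem_orthogonal_vectorSpan_range_iff {ι : Type*} {P : ι → E} {u : E} :
    u ∈ (vectorSpan ℝ (Set.range P))ᗮ ↔ ∀ i j, inner ℝ u (P i) = inner ℝ u (P j) := by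
  constructor
  · intro hu i j
    have h := (Submodule.mem_orthogonal' _ _).1 hu (P i -ᵥ P j)
      (vsub_mem_vectorSpan ℝ (Set.mem_range_self i) (Set.mem_range_self j))
    rwa [vsub_eq_sub, inner_sub_right, sub_eq_zero] at h
  · intro h
    have hle : vectorSpan ℝ (Set.range P) ≤ (ℝ ∙ u)ᗮ := by
      rw [vectorSpan_def, Submodule.span_le]
      rintro _ ⟨_, ⟨i, rfl⟩, _, ⟨j, rfl⟩, rfl⟩
      rw [SetLike.mem_coe, Submodule.mem_orthogonal_singleton_iff_inner_right]
      change inner ℝ u (P i - P j) = 0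
      rw [inner_sub_right, sub_eq_zero]
      exact h i j
    rw [Submodule.mem_orthogonal']
    intro w hw
    exact Submodule.mem_orthogonal_singleton_iff_inner_right.1 (hle hw)

theorem cthickening_affineSpan_subset_slab {ι : Type*} {P : ι → E} {u : E} (hu : ‖u‖ = 1)
    (hP : ∀ i j, inner ℝ u (P i) = inner ℝ u (P j)) (i₀ : ι) {r : ℝ} (hr : 0 < r) :
    Metric.cthickening r (affineSpan ℝ (Set.range P) : Set E) ⊆
      {x | |inner ℝ u x - inner ℝ u (P i₀)| ≤ r} := by
  intro x hx
  rw [Set.mem_ofPred_eq]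
  refine le_of_forall_gt_imp_ge_of_dense fun r' hr' => ?_
  obtain ⟨y, hy, hxy⟩ := Metric.mem_thickening_iff.1
    (Metric.cthickening_subset_thickening' (hr.trans hr') hr' _ hx)
  have hdir : y -ᵥ P i₀ ∈ vectorSpan ℝ (Set.range P) := by
    rw [← direction_affineSpan]
    exact AffineSubspace.vsub_mem_direction hy (subset_affineSpan ℝ _ (Set.mem_range_self i₀))
  have h := (Submodule.mem_orthogonal' _ _).1 (mem_orthogonal_vectorSpan_range_iff.2 hP) _ hdir
  rw [vsub_eq_sub, inner_sub_right, sub_eq_zero] at h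
  rw [← h, ← inner_sub_right]
  refine (abs_real_inner_le_norm _ _).trans ?_
  rw [hu, one_mul, ← dist_eq_norm]
  exact hxy.le

/-- The plane spanned by an orthonormal pair contains a unit vector orthogonal to a given one. -/
theorem exists_unit_combination_orthogonal {p q : E} (hp : ‖p‖ = 1) (hq : ‖q‖ = 1)
    (hpq : inner ℝ p q = 0) (e : E) :
    ∃ a b : ℝ, a ^ 2 + b ^ 2 = 1 ∧ ‖a • p + b • q‖ = 1 ∧ inner ℝ (a • p + b • q) e = 0 := by
  obtain ⟨a, b, hab, he⟩ : ∃ a b : ℝ, a ^ 2 + b ^ 2 = 1 ∧ a * inner ℝ p e + b * inner ℝ q e = 0 := by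
    set x := inner ℝ p e
    set y := inner ℝ q e
    by_cases h : x ^ 2 + y ^ 2 = 0
    · have hx : x = 0 := by nlinarith [sq_nonneg x, sq_nonneg y]
      exact ⟨1, 0, by norm_num, by rw [hx]; ring⟩
    · have hpos : 0 < x ^ 2 + y ^ 2 := lt_of_le_of_ne (by positivity) (Ne.symm h)
      have hs : Real.sqrt (x ^ 2 + y ^ 2) ≠ 0 := (Real.sqrt_pos.2 hpos).ne'
      refine ⟨y / Real.sqrt (x ^ 2 + y ^ 2), -x / Real.sqrt (x ^ 2 + y ^ 2), ?_, by ring⟩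
      rw [div_pow, div_pow, Real.sq_sqrt hpos.le, ← add_div, div_eq_one_iff_eq h]
      ring
  refine ⟨a, b, hab, ?_, by
    rw [inner_add_left, real_inner_smul_left, real_inner_smul_left, he]⟩
  have hsq : ‖a • p + b • q‖ ^ 2 = 1 := by
    rw [norm_add_sq_real, norm_smul, norm_smul, real_inner_smul_left, real_inner_smul_right, hp, hq,
      hpq, mul_one, mul_one, Real.norm_eq_abs, Real.norm_eq_abs, sq_abs, sq_abs]
    linarith
  nlinarith [norm_nonneg (a • p + b • q)]

variable [FiniteDimensional ℝ E]

theorem exists_unit_normal {ι : Type*} [Fintype ι] [Nonempty ι] (P : ι → E)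
    (hι : Fintype.card ι ≤ Module.finrank ℝ E) :
    ∃ u : E, ‖u‖ = 1 ∧ ∀ i j, inner ℝ u (P i) = inner ℝ u (P j) := by
  have hcard : 0 < Fintype.card ι := Fintype.card_pos
  have h1 := finrank_vectorSpan_range_le ℝ P (n := Fintype.card ι - 1) (by omega)
  have h2 := (vectorSpan ℝ (Set.range P)).finrank_add_finrank_orthogonal
  have : Nontrivial (vectorSpan ℝ (Set.range P))ᗮ :=
    Module.nontrivial_of_finrank_pos (R := ℝ) (by omega)
  obtain ⟨u, hu⟩ := exists_norm_eq (vectorSpan ℝ (Set.range P))ᗮ (zero_le_one (α := ℝ))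
  exact ⟨u, hu, mem_orthogonal_vectorSpan_range_iff.1 u.2⟩

variable [MeasurableSpace E] [BorelSpace E]

/-- If the affine hulls of `P` and `Q` have unit normals `u` and `v` at an angle whose sine exceeds
`δ`, then their neighborhoods meet in a set of small Gaussian measure. -/
theorem stdGaussian_cthickening_inter_lt {ι : Type*} [Nonempty ι] {P Q : ι → E} {u v : E}
    (hu : ‖u‖ = 1) (hv : ‖v‖ = 1) (hP : ∀ i j, inner ℝ u (P i) = inner ℝ u (P j))
    (hQ : ∀ i j, inner ℝ v (Q i) = inner ℝ v (Q j)) {δ ε : ℝ} (hδ : 0 < δ) (hε : 0 < ε)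
    (huv : inner ℝ u v ^ 2 < 1 - δ ^ 2) :
    ProbabilityTheory.stdGaussian E
        (Metric.cthickening (ε / 2) (affineSpan ℝ (Set.range P) : Set E) ∩
          Metric.cthickening (ε / 2) (affineSpan ℝ (Set.range Q) : Set E)) <
      ENNReal.ofReal (ε ^ 2 / (2 * Real.pi * δ)) := by
  obtain ⟨i₀⟩ := ‹Nonempty ι›
  have hs : δ < Real.sqrt (1 - inner ℝ u v ^ 2) := Real.lt_sqrt_of_sq_lt (by linarith)
  have hs0 := hδ.trans hs
  refine lt_of_le_of_lt (measure_mono (Set.inter_subset_inter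
    (cthickening_affineSpan_subset_slab hu hP i₀ (half_pos hε))
    (cthickening_affineSpan_subset_slab hv hQ i₀ (half_pos hε)))) ?_
  refine lt_of_le_of_lt (stdGaussian_slab_inter_slab_le hu hv hs0
    (Real.sq_sqrt (by nlinarith)) _ _ hε.le) ?_
  rw [ENNReal.ofReal_lt_ofReal_iff (by positivity)]
  have := Real.pi_pos
  gcongr

/-- For fixed `A` and `v`, it is unlikely that every unit normal to the affine hull of `A` and of
independent standard Gaussian vectors `S` is almost parallel to `v`. -/
theorem pi_stdGaussian_normals_near_le {k n : ℕ} (hn : 2 ≤ n) (hE : Module.finrank ℝ E = k + n)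
    (A : Fin k → E) {v : E} (hv : ‖v‖ = 1) (hA : ∀ i j, inner ℝ v (A i) = inner ℝ v (A j))
    {δ : ℝ} (hδ : 0 < δ) (hδ1 : δ < 1) :
    (Measure.pi fun _ : Fin n => ProbabilityTheory.stdGaussian E)
        {S | ∀ u : E, ‖u‖ = 1 →
          (∀ i j, inner ℝ u (Sum.elim A S i) = inner ℝ u (Sum.elim A S j)) →
          1 - δ ^ 2 ≤ inner ℝ u v ^ 2} ≤
      ENNReal.ofReal (2 * (Real.sqrt 2 * δ) ^ (n - 2)) := by
  let j₀ : Fin n := ⟨0, by omega⟩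
  let j₁ : Fin n := ⟨1, by omega⟩
  set W := (vectorSpan ℝ (Set.range A))ᗮ with hW
  have hWdim := (vectorSpan ℝ (Set.range A)).finrank_add_finrank_orthogonal
  rw [← hW] at hWdim
  have hvW : v ∈ W := mem_orthogonal_vectorSpan_range_iff.2 hA
  obtain ⟨J, hJ, hm, e, hN⟩ : ∃ J : Finset (Fin n), J.card + 2 ≤ Module.finrank ℝ W ∧
      n - 2 + 2 ≤ Module.finrank ℝ W ∧ ∃ e : (Fin n → E) → E, ∀ S, ∀ u ∈ W, (∀ j ∈ J, inner ℝ u (S j - S j₀) = 0) →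
        inner ℝ u (e S) = 0 → ∃ c, ∀ i, inner ℝ u (Sum.elim A S i) = c := by
    rcases Nat.eq_zero_or_pos k with rfl | hk
    · have h0 : Module.finrank ℝ (vectorSpan ℝ (Set.range A)) = 0 := by
        rw [Set.range_eq_empty, vectorSpan_empty, finrank_bot]
      refine ⟨{j₀, j₁}ᶜ, ?_, by omega, fun S => S j₁ - S j₀, fun S u _ hJ he => ⟨inner ℝ u (S j₀), ?_⟩⟩
      · rw [Finset.card_compl, Finset.card_pair (by simp [j₀, j₁]), Fintype.card_fin]
        omega
      · rintro (i | j)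
        · exact i.elim0
        · by_cases hj : j ∈ ({j₀, j₁} : Finset (Fin n))
          · rcases Finset.mem_insert.1 hj with rfl | hj
            · rfl
            · rw [Finset.mem_singleton.1 hj]
              rwa [inner_sub_right, sub_eq_zero] at he
          · have := hJ j (Finset.mem_compl.2 hj)
            rwa [inner_sub_right, sub_eq_zero] at this
    · let i₀ : Fin k := ⟨0, hk⟩
      have h1 := finrank_vectorSpan_range_le ℝ A (n := k - 1) (by rw [Fintype.card_fin]; omega)
      refine ⟨{j₀}ᶜ, ?_, by omega, fun S => S j₀ - A i₀, fun S u hu hJ he => ⟨inner ℝ u (A i₀), ?_⟩⟩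
      · rw [Finset.card_compl, Finset.card_singleton, Fintype.card_fin]
        omega
      · rw [inner_sub_right, sub_eq_zero] at he
        rintro (i | j)
        · exact mem_orthogonal_vectorSpan_range_iff.1 hu i i₀
        · by_cases hj : j = j₀
          · rw [hj]; exact he
          · have := hJ j (by simpa using hj)
            rw [inner_sub_right, sub_eq_zero] at this
            exact this.trans he
  refine (measure_mono fun S hS p q hpW hqW hp hq hpq hpS hqS => ?_).trans
    (pi_stdGaussian_near_planes_le W J j₀ hJ hm hvW hv hδ hδ1)
  obtain ⟨a, b, hab, hun, hue⟩ := exists_unit_combination_orthogonal hp hq hpq (e S)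
  obtain ⟨c, hc⟩ := hN S (a • p + b • q) (W.add_mem (W.smul_mem _ hpW) (W.smul_mem _ hqW))
    (fun j hj => by
      rw [inner_add_left, real_inner_smul_left, real_inner_smul_left, hpS j hj, hqS j hj]; ring)
    hue
  have h := hS _ hun fun i j => (hc i).trans (hc j).symm
  rw [inner_add_left, real_inner_smul_left, real_inner_smul_left] at h
  set x := inner ℝ p v
  set y := inner ℝ q v
  have hcs : (a * x + b * y) ^ 2 + (a * y - b * x) ^ 2 = (a ^ 2 + b ^ 2) * (x ^ 2 + y ^ 2) := by
    ring
  rw [hab] at hcs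
  nlinarith [sq_nonneg (a * y - b * x)]

/-- All pairs of unit normals to the affine hulls of `A, S` and of `A, T` are almost parallel with
small probability. -/
theorem prod_stdGaussian_normals_near_le {k n : ℕ} (hn : 2 ≤ n) (hE : Module.finrank ℝ E = k + n)
    {δ : ℝ} (hδ : 0 < δ) (hδ1 : δ < 1) :
    ((Measure.pi fun _ : Fin k => ProbabilityTheory.stdGaussian E).prod
        ((Measure.pi fun _ : Fin n => ProbabilityTheory.stdGaussian E).prod
          (Measure.pi fun _ : Fin n => ProbabilityTheory.stdGaussian E)))
        {ω | ∀ u v : E, ‖u‖ = 1 → ‖v‖ = 1 →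
          (∀ i j, inner ℝ u (Sum.elim ω.1 ω.2.1 i) = inner ℝ u (Sum.elim ω.1 ω.2.1 j)) →
          (∀ i j, inner ℝ v (Sum.elim ω.1 ω.2.2 i) = inner ℝ v (Sum.elim ω.1 ω.2.2 j)) →
          1 - δ ^ 2 ≤ inner ℝ u v ^ 2} ≤
      ENNReal.ofReal (2 * (Real.sqrt 2 * δ) ^ (n - 2)) := by
  set G := {ω : (Fin k → E) × (Fin n → E) × (Fin n → E) | ∀ u v : E, ‖u‖ = 1 → ‖v‖ = 1 →
          (∀ i j, inner ℝ u (Sum.elim ω.1 ω.2.1 i) = inner ℝ u (Sum.elim ω.1 ω.2.1 j)) →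
          (∀ i j, inner ℝ v (Sum.elim ω.1 ω.2.2 i) = inner ℝ v (Sum.elim ω.1 ω.2.2 j)) →
          1 - δ ^ 2 ≤ inner ℝ u v ^ 2} with hG
  let C : Set (((Fin k → E) × (Fin n → E) × (Fin n → E)) ×
      (Metric.sphere (0 : E) 1 × Metric.sphere (0 : E) 1)) :=
    {z | (∀ i j, inner ℝ (z.2.1 : E) (Sum.elim z.1.1 z.1.2.1 i) =
        inner ℝ (z.2.1 : E) (Sum.elim z.1.1 z.1.2.1 j)) ∧
      ∀ i j, inner ℝ (z.2.2 : E) (Sum.elim z.1.1 z.1.2.2 i) =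
        inner ℝ (z.2.2 : E) (Sum.elim z.1.1 z.1.2.2 j)}
  have hC : IsClosed C := by
    have hcont (g : ((Fin k → E) × (Fin n → E) × (Fin n → E)) ×
        (Metric.sphere (0 : E) 1 × Metric.sphere (0 : E) 1) → Fin n → E) (hg : Continuous g)
        (i : Fin k ⊕ Fin n) : Continuous fun z => Sum.elim z.1.1 (g z) i := by
      rcases i with i | i
      · simp only [Sum.elim_inl]; fun_prop
      · simp only [Sum.elim_inr]; fun_prop
    have h1 := hcont (fun z => z.1.2.1) (by fun_prop)
    have h2 := hcont (fun z => z.1.2.2) (by fun_prop)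
    simp only [C, Set.ofPred_and, Set.ofPred_forall]
    exact (isClosed_iInter fun i => isClosed_iInter fun j => isClosed_eq
      (.inner (by fun_prop) (h1 i)) (.inner (by fun_prop) (h1 j))).inter
      (isClosed_iInter fun i => isClosed_iInter fun j => isClosed_eq
      (.inner (by fun_prop) (h2 i)) (.inner (by fun_prop) (h2 j)))
  have hGm : MeasurableSet G := by
    have h := measurableSet_forall_mem_le hC (f := fun _ => 1 - δ ^ 2)
      (g := fun z => inner ℝ (z.2.1 : E) (z.2.2 : E) ^ 2) (by fun_prop) (by fun_prop)
    convert h using 1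
    ext ω
    constructor
    · exact fun hω y hy => hω y.1 y.2 (norm_eq_of_mem_sphere y.1) (norm_eq_of_mem_sphere y.2)
        hy.1 hy.2
    · exact fun hω u v hu hv hu' hv' =>
        hω (⟨u, by simpa using hu⟩, ⟨v, by simpa using hv⟩) ⟨hu', hv'⟩
  rw [Measure.prod_apply hGm]
  refine (lintegral_mono (g := fun _ => ENNReal.ofReal (2 * (Real.sqrt 2 * δ) ^ (n - 2)))
    fun A => ?_).trans_eq (by simp)
  rw [Measure.prod_apply_symm (measurable_prodMk_left hGm)]
  refine (lintegral_mono (g := fun _ => ENNReal.ofReal (2 * (Real.sqrt 2 * δ) ^ (n - 2)))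
    fun T => ?_).trans_eq (by simp)
  have : Nonempty (Fin k ⊕ Fin n) := ⟨Sum.inr ⟨0, by omega⟩⟩
  obtain ⟨v, hv, hvT⟩ := exists_unit_normal (Sum.elim A T) (by simp [hE])
  refine (measure_mono fun S hS u hu huS => ?_).trans (pi_stdGaussian_normals_near_le hn hE A hv
    (fun i j => hvT (Sum.inl i) (Sum.inl j)) hδ hδ1)
  exact hS u v hu hv huS hvT

end Hyperplanes

theorem stdGaussian_eq_stdGaussian_euclideanSpace (d : ℕ) :
    _root_.stdGaussian d = ProbabilityTheory.stdGaussian (EuclideanSpace ℝ (Fin d)) :=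
  map_pi_eq_stdGaussian

/-- Lemma: let `0 ≤ k ≤ d` and let `A₁,…,A_k, S₁,…,S_{d-k}, T₁,…,T_{d-k}` be iid standard
Gaussian vectors in `ℝ^d`. Let `B_S`, `B_T` be the `(ε/2)`-neighborhoods of
`aff{A₁,…,A_k,S₁,…,S_{d-k}}` and `aff{A₁,…,A_k,T₁,…,T_{d-k}}`. Then for every `t > 2π`,
`ℙ(𝒢(B_S ∩ B_T) ≥ ε² t/√(2π)) ≤ 3 (π^{3/2}/√(2t))^{d-k-2}`. -/
theorem stmt19 (d k : ℕ) (hk : k ≤ d) (ε : ℝ) (hε : 0 < ε)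
    (t : ℝ) (ht : 2 * Real.pi < t) :
    (Measure.pi fun _ : Fin k ⊕ Fin (d - k) ⊕ Fin (d - k) => stdGaussian d)
        {ω : Fin k ⊕ Fin (d - k) ⊕ Fin (d - k) → EuclideanSpace ℝ (Fin d) |
          ENNReal.ofReal (ε ^ 2 * t / Real.sqrt (2 * Real.pi)) ≤
            stdGaussian d
              (Metric.cthickening (ε / 2)
                  (affineSpan ℝ
                    ((Set.range fun i : Fin k => ω (Sum.inl i)) ∪
                      (Set.range fun j : Fin (d - k) => ω (Sum.inr (Sum.inl j)))) :
                    Set (EuclideanSpace ℝ (Fin d))) ∩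
                Metric.cthickening (ε / 2)
                  (affineSpan ℝ
                    ((Set.range fun i : Fin k => ω (Sum.inl i)) ∪
                      (Set.range fun j : Fin (d - k) => ω (Sum.inr (Sum.inr j)))) :
                    Set (EuclideanSpace ℝ (Fin d))))} ≤
      ENNReal.ofReal (3 * (Real.pi ^ ((3 : ℝ) / 2) / Real.sqrt (2 * t)) ^ (d - k - 2)) := by
  rcases le_or_gt (d - k) 2 with hn | hn
  · rw [stdGaussian_eq_stdGaussian_euclideanSpace, Nat.sub_eq_zero_of_le hn, pow_zero, mul_one]
    exact prob_le_one.trans (by rw [ENNReal.one_le_ofReal]; norm_num)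
  have hπ : 3 < Real.pi := Real.pi_gt_three
  have hπ0 : 0 < Real.pi := by linarith
  have ht6 : 6 < t := by linarith
  have ht0 : 0 < t := by linarith
  have hsqrt : 0 < Real.sqrt (2 * Real.pi) := by positivity
  set δ : ℝ := 1 / (t * Real.sqrt (2 * Real.pi)) with hδ
  have hδ0 : 0 < δ := by positivity
  have hδ1 : δ < 1 := by
    have : 1 ≤ Real.sqrt (2 * Real.pi) := Real.one_le_sqrt.2 (by linarith)
    rw [hδ, div_lt_one (by positivity)]
    nlinarith
  have hthreshold : ε ^ 2 * t / Real.sqrt (2 * Real.pi) = ε ^ 2 / (2 * Real.pi * δ) := by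
    have h2 : Real.sqrt (2 * Real.pi) ^ 2 = 2 * Real.pi := Real.sq_sqrt (by positivity)
    rw [← h2, hδ, Real.sqrt_sq hsqrt.le]
    field_simp
  have hδle : Real.sqrt 2 * δ ≤ Real.pi ^ ((3 : ℝ) / 2) / Real.sqrt (2 * t) := by
    have h1 : (1 : ℝ) ≤ Real.pi ^ ((3 : ℝ) / 2) := Real.one_le_rpow (by linarith) (by norm_num)
    refine le_trans ?_ (div_le_div_of_nonneg_right h1 (Real.sqrt_nonneg _))
    have h2 : Real.sqrt (2 * t) ≤ t := Real.sqrt_le_iff.2 ⟨ht0.le, by nlinarith⟩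
    have h3 : Real.sqrt 2 ≤ Real.sqrt (2 * Real.pi) := Real.sqrt_le_sqrt (by linarith)
    rw [hδ, mul_one_div, div_le_div_iff₀ (by positivity) (by positivity), one_mul]
    nlinarith [mul_le_mul h3 h2 (Real.sqrt_nonneg _) hsqrt.le]
  have hmp := ((MeasurePreserving.id (Measure.pi fun _ : Fin k =>
      ProbabilityTheory.stdGaussian (EuclideanSpace ℝ (Fin d)))).prod
    (measurePreserving_sumPiEquivProdPi
      (fun _ : Fin (d - k) ⊕ Fin (d - k) =>
        ProbabilityTheory.stdGaussian (EuclideanSpace ℝ (Fin d))))).comp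
    (measurePreserving_sumPiEquivProdPi
      (fun _ : Fin k ⊕ Fin (d - k) ⊕ Fin (d - k) =>
        ProbabilityTheory.stdGaussian (EuclideanSpace ℝ (Fin d))))
  have : Nonempty (Fin k ⊕ Fin (d - k)) := ⟨Sum.inr ⟨0, by omega⟩⟩
  simp only [stdGaussian_eq_stdGaussian_euclideanSpace, hthreshold]
  refine (measure_mono fun ω hω u v hu hv huS hvT => ?_).trans
    ((hmp.measure_preimage_le _).trans ((prod_stdGaussian_normals_near_le hn.le (by simp [hk])
      hδ0 hδ1).trans (ENNReal.ofReal_le_ofReal ?_)))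
  · by_contra! hlt
    have h := stdGaussian_cthickening_inter_lt hu hv huS hvT hδ0 hε hlt
    rw [Set.Sum.elim_range, Set.Sum.elim_range] at h
    exact absurd hω (not_le.2 h)
  · gcongr
    norm_num
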